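/- Let a,b,s,t be nonnegative reals with s² ≥ 4t and a·(s+√(s²−4t))/2 ≥ b. Then the Hankel matrix H = [r_{n+m,0}]_{n,m≥0} of the Catalan-like numbers of R(a,b;s,t) is totally positive. -/

import Mathlib

/-- An infinite real matrix `M` is totally positive (TP) if every minor
(determinant of a square submatrix with rows and columns chosen in
increasing order) is nonnegative. -/
def IsTP (M : ℕ → ℕ → ℝ) : Prop :=
  ∀ k : ℕ, ∀ rows cols : Fin k → ℕ, StrictMono rows → StrictMono cols →
    0 ≤ (Matrix.of fun i j => M (rows i) (cols j)).det

theorem IsTP.transpose {M : ℕ → ℕ → ℝ} (hM : IsTP M) : IsTP (fun n m => M m n) := by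
  intro k r c hr hc
  rw [← Matrix.det_transpose]
  exact hM k c r hc hr

/-- A minor taken along a weakly increasing family of columns is nonnegative. -/
theorem IsTP.det_nonneg_of_monotone {M : ℕ → ℕ → ℝ} (hM : IsTP M) {k : ℕ} {r c : Fin k → ℕ}
    (hr : StrictMono r) (hc : Monotone c) :
    0 ≤ (Matrix.of fun i j => M (r i) (c j)).det := by
  by_cases h : Function.Injective c
  · exact hM k r c hr (hc.strictMono_of_injective h)
  · simp only [Function.Injective, not_forall] at h
    obtain ⟨i, j, hij, hne⟩ := h
    rw [Matrix.det_zero_of_column_eq hne]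
    intro l
    simp [hij]

theorem IsTP.mul_col {M : ℕ → ℕ → ℝ} (hM : IsTP M) {w : ℕ → ℝ} (hw : ∀ m, 0 ≤ w m) :
    IsTP (fun n m => w m * M n m) := by
  intro k r c hr hc
  have := Matrix.det_mul_row (fun j => w (c j)) (Matrix.of fun i j => M (r i) (c j))
  simp only [Matrix.of_apply] at this
  rw [this]
  exact mul_nonneg (Finset.prod_nonneg fun _ _ => hw _) (hM k r c hr hc)

/-- Total positivity is preserved by adding to each column a nonnegative multiple of the
preceding one. -/
theorem IsTP.add_mul_prev_col {M : ℕ → ℕ → ℝ} (hM : IsTP M) {w : ℕ → ℝ} (hw : ∀ m, 0 ≤ w m) :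
    IsTP (fun n m => M n m + w m * M n (m - 1)) := by
  intro k r c hr hc
  let x : Fin k → Fin k → ℝ := fun j i => M (r i) (c j)
  let y : Fin k → Fin k → ℝ := fun j i => w (c j) * M (r i) (c j - 1)
  have hxy : (Matrix.of fun i j => M (r i) (c j) + w (c j) * M (r i) (c j - 1)).det
      = Matrix.detRowAlternating (x + y) := by
    rw [← Matrix.det_transpose]
    rfl
  have hadd := Matrix.detRowAlternating (R := ℝ) (n := Fin k).toMultilinearMap.map_add_univ x y
  simp only [AlternatingMap.coe_multilinearMap] at hadd
  rw [hxy, hadd]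
  refine Finset.sum_nonneg fun S _ => ?_
  let c' : Fin k → ℕ := fun j => if j ∈ S then c j else c j - 1
  let u : Fin k → ℝ := fun j => if j ∈ S then 1 else w (c j)
  have hc' : Monotone c' := by
    intro i j hij
    rcases hij.eq_or_lt with rfl | hlt
    · rfl
    · have := hc hlt
      simp only [c']
      split_ifs <;> omega
  have hdet : Matrix.detRowAlternating (S.piecewise x y)
      = (∏ j, u j) * (Matrix.of fun i j => M (r i) (c' j)).det := by
    rw [← Matrix.det_mul_row, ← Matrix.det_transpose]
    change Matrix.det _ = _
    congr 1
    ext j i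
    by_cases hj : j ∈ S <;> simp [Finset.piecewise, hj, x, y, u, c']
  rw [hdet]
  refine mul_nonneg (Finset.prod_nonneg fun j _ => ?_) (hM.det_nonneg_of_monotone hr hc')
  simp only [u]
  split_ifs
  · exact zero_le_one
  · exact hw _

theorem isTP_single : IsTP (fun n => Pi.single n 1) := by
  intro k r c hr hc
  by_cases h : ∀ i, r i ∈ Set.range c
  · have hrc : r = c := by
      refine (hr.range_inj hc).1 ?_
      have hsub : Finset.univ.image r ⊆ Finset.univ.image c := by
        intro x hx
        obtain ⟨i, -, rfl⟩ := Finset.mem_image.1 hx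
        obtain ⟨j, hj⟩ := h i
        exact Finset.mem_image.2 ⟨j, Finset.mem_univ _, hj⟩
      have heq := Finset.eq_of_subset_of_card_le hsub (by
        rw [Finset.card_image_of_injective _ hr.injective,
          Finset.card_image_of_injective _ hc.injective])
      simpa using congrArg (fun s : Finset ℕ => (s : Set ℕ)) heq
    subst hrc
    have : (Matrix.of fun i j => (Pi.single (r i) 1 : ℕ → ℝ) (r j)) = 1 := by
      ext i j
      simp [Matrix.one_apply, Pi.single_apply, hr.injective.eq_iff, eq_comm]
    rw [this, Matrix.det_one]
    exact zero_le_one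
  · push Not at h
    obtain ⟨i, hi⟩ := h
    rw [Matrix.det_eq_zero_of_row_eq_zero i]
    intro j
    have : c j ≠ r i := fun hj => hi ⟨j, hj⟩
    simp [Pi.single_apply, this]

/-- The action on column vectors of the tridiagonal matrix with diagonal `a, s, s, …`,
superdiagonal `1, 1, …` and subdiagonal `b, t, t, …`. -/
def tridiag (a b s t : ℝ) : (ℕ → ℝ) →ₗ[ℝ] (ℕ → ℝ) where
  toFun f k := match k with
    | 0 => a * f 0 + f 1
    | 1 => b * f 0 + s * f 1 + f 2
    | k + 2 => t * f (k + 1) + s * f (k + 2) + f (k + 3)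
  map_add' f g := by
    ext k
    match k with
    | 0 | 1 | k + 2 => simp only [Pi.add_apply]; ring
  map_smul' x f := by
    ext k
    match k with
    | 0 | 1 | k + 2 => simp only [Pi.smul_apply, smul_eq_mul, RingHom.id_apply]; ring

section tridiag

variable {a b s t : ℝ}

theorem tridiag_zero (f : ℕ → ℝ) : tridiag a b s t f 0 = a * f 0 + f 1 := rfl

theorem tridiag_one (f : ℕ → ℝ) : tridiag a b s t f 1 = b * f 0 + s * f 1 + f 2 := rfl

theorem tridiag_add_two (f : ℕ → ℝ) (k : ℕ) :
    tridiag a b s t f (k + 2) = t * f (k + 1) + s * f (k + 2) + f (k + 3) := rfl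

theorem tridiag_single_zero :
    tridiag a b s t (Pi.single 0 1) = a • Pi.single 0 1 + b • Pi.single 1 1 := by
  ext k
  match k with
  | 0 => simp [tridiag_zero]
  | 1 => simp [tridiag_one]
  | k + 2 => simp [tridiag_add_two]

theorem tridiag_single_succ (j : ℕ) :
    tridiag a b s t (Pi.single (j + 1) 1)
      = Pi.single j 1 + s • Pi.single (j + 1) 1 + t • Pi.single (j + 2) 1 := by
  ext k
  match k with
  | 0 => simp [tridiag_zero, Pi.single_apply, eq_comm]
  | 1 => simp [tridiag_one, Pi.single_apply, eq_comm]; ring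
  | k + 2 => simp [tridiag_add_two, Pi.single_apply, eq_comm]; ring

/-- The parameters of a factorization of the tridiagonal matrix into nonnegative bidiagonal
ones: the subdiagonal of the lower factor is `e`, the diagonal of the upper factor is
`a, s - e 0, s - e 1, …`. -/
theorem exists_bidiagonal_params (ha : 0 ≤ a) (hb : 0 ≤ b) (hs : 0 ≤ s) (ht : 0 ≤ t)
    (h1 : s ^ 2 ≥ 4 * t) (h2 : a * (s + Real.sqrt (s ^ 2 - 4 * t)) / 2 ≥ b) :
    ∃ e : ℕ → ℝ, (∀ j, 0 ≤ e j) ∧ (∀ j, e j ≤ s) ∧ e 0 * a = b ∧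
      ∀ j, e (j + 1) * (s - e j) = t := by
  set q := Real.sqrt (s ^ 2 - 4 * t) with hq
  have hq0 : 0 ≤ q := Real.sqrt_nonneg _
  have hqq : q ^ 2 = s ^ 2 - 4 * t := Real.sq_sqrt (by linarith)
  have hqs : q ≤ s := by nlinarith
  set x := (s + q) / 2 with hx
  have hx0 : 0 ≤ x := by positivity
  have hxs : x ≤ s := by linarith
  have hxt : x * (s - x) = t := by rw [hx]; nlinarith
  have hbx : b ≤ x * a := by rw [hx]; linarith
  have hdiv : ∀ c d : ℝ, 0 ≤ c → 0 ≤ d → c ≤ x * d → 0 ≤ c / d ∧ c / d ≤ x ∧ c / d * d = c := by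
    intro c d hc hd hcd
    refine ⟨div_nonneg hc hd, div_le_of_le_mul₀ hd hx0 hcd, div_mul_cancel_of_imp fun h => ?_⟩
    subst h
    linarith
  let e : ℕ → ℝ := fun n => Nat.rec (b / a) (fun _ y => t / (s - y)) n
  have h0 := hdiv b a hb ha hbx
  have hstep : ∀ y, y ≤ x → 0 ≤ t / (s - y) ∧ t / (s - y) ≤ x ∧ t / (s - y) * (s - y) = t :=
    fun y hy => hdiv t (s - y) ht (by linarith) (by nlinarith)
  have he : ∀ j, 0 ≤ e j ∧ e j ≤ x := by
    intro j
    induction j with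
    | zero => exact ⟨h0.1, h0.2.1⟩
    | succ j ih => exact ⟨(hstep _ ih.2).1, (hstep _ ih.2).2.1⟩
  exact ⟨e, fun j => (he j).1, fun j => (he j).2.trans hxs, h0.2.2,
    fun j => (hstep _ (he j).2).2.2⟩

/-- Replacing the `m`-th column of a totally positive matrix by the combination of its columns
given by the first row of the `m`-th power of the tridiagonal matrix preserves total
positivity. -/
theorem IsTP.tridiag_pow (ha : 0 ≤ a) (hb : 0 ≤ b) (hs : 0 ≤ s) (ht : 0 ≤ t)
    (h1 : s ^ 2 ≥ 4 * t) (h2 : a * (s + Real.sqrt (s ^ 2 - 4 * t)) / 2 ≥ b)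
    {M : ℕ → ℕ → ℝ} (hM : IsTP M) :
    IsTP (fun n m => ((tridiag a b s t) ^ m) (M n) 0) := by
  obtain ⟨e, he0, hes, hea, het⟩ := exists_bidiagonal_params ha hb hs ht h1 h2
  have key : ∀ p, IsTP (fun n m => ((tridiag a b s t) ^ min m p) (M n) (m - p)) := by
    intro p
    induction p with
    | zero => simpa using hM
    | succ p ih =>
      let d : ℕ → ℝ := fun j => if j = 0 then a else s - e (j - 1)
      let v : ℕ → ℝ := fun m => if m ≤ p then 0 else d (m - p - 1)
      let w : ℕ → ℝ := fun m => if m ≤ p + 1 then 0 else e (m - p - 2)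
      have hv : ∀ m, 0 ≤ v m := by
        intro m
        simp only [v, d]
        split_ifs
        · exact le_rfl
        · exact ha
        · exact sub_nonneg.2 (hes _)
      have hw : ∀ m, 0 ≤ w m := by
        intro m
        simp only [w]
        split_ifs
        · exact le_rfl
        · exact he0 _
      convert (ih.add_mul_prev_col hv).add_mul_prev_col hw using 3 with n m
      have hsucc : ((tridiag a b s t) ^ (p + 1)) (M n)
          = tridiag a b s t (((tridiag a b s t) ^ p) (M n)) := by
        rw [pow_succ']; rfl
      obtain hm | ⟨j, rfl⟩ : m ≤ p ∨ ∃ j, m = p + 1 + j := by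
        by_cases hm : m ≤ p
        · exact Or.inl hm
        · exact Or.inr ⟨m - (p + 1), by omega⟩
      · have hw0 : w m = 0 := if_pos (by omega)
        have hv0 : v m = 0 := if_pos hm
        rw [hw0, hv0, min_eq_left hm, min_eq_left (by omega), Nat.sub_eq_zero_of_le hm,
          Nat.sub_eq_zero_of_le (by omega)]
        ring
      · have hmin : ∀ i, min (p + i) p = p := fun i => min_eq_right (by omega)
        rw [min_eq_right (by omega : p + 1 ≤ p + 1 + j), hsucc, Nat.add_sub_cancel_left]
        match j with
        | 0 =>
          have hw0 : w (p + 1 + 0) = 0 := if_pos (by omega)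
          have hv0 : v (p + 1 + 0) = a := by simp [v, d]
          rw [hw0, hv0]
          simp [tridiag_zero]
          ring
        | 1 =>
          have hw0 : w (p + 1 + 1) = e 0 := by simp [w, add_assoc]
          have hv0 : v (p + 1 + 1) = s - e 0 := by simp [v, d, add_assoc]
          have hv1 : v (p + 1 + 1 - 1) = a := by simp [v, d]
          rw [hw0, hv0, hv1, show p + 1 + 1 - 1 = p + 1 by omega, show p + 1 + 1 = p + 2 by omega,
            show p + 1 - 1 = p + 0 by omega, hmin, hmin, hmin]
          simp only [Nat.add_sub_cancel_left, tridiag_one]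
          rw [← hea]
          ring
        | j + 2 =>
          have hw0 : w (p + 1 + (j + 2)) = e (j + 1) := by
            simp only [w]
            rw [if_neg (by omega)]
            congr 1
            omega
          have hv0 : v (p + 1 + (j + 2)) = s - e (j + 1) := by
            simp only [v, d]
            rw [if_neg (by omega), if_neg (by omega)]
            congr 2
            omega
          have hv1 : v (p + 1 + (j + 2) - 1) = s - e j := by
            simp only [v, d]
            rw [if_neg (by omega), if_neg (by omega)]
            congr 2
            omega
          rw [hw0, hv0, hv1, show p + 1 + (j + 2) - 1 = p + (j + 2) by omega,
            show p + 1 + (j + 2) = p + (j + 3) by omega,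
            show p + (j + 2) - 1 = p + (j + 1) by omega, hmin, hmin, hmin]
          simp only [Nat.add_sub_cancel_left, tridiag_add_two]
          rw [← het j]
          ring
  intro k r c hr hc
  have hbd : ∀ j, c j ≤ ∑ i, c i := fun j =>
    Finset.single_le_sum (fun i _ => Nat.zero_le (c i)) (Finset.mem_univ j)
  have := key (∑ i, c i) k r c hr hc
  simpa only [fun j => min_eq_left (hbd j), fun j => Nat.sub_eq_zero_of_le (hbd j)] using this

variable {R : ℕ → ℕ → ℝ}

theorem tridiag_pow_single_zero (hR00 : R 0 0 = 1) (htri : ∀ n k, n < k → R n k = 0)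
    (hcol0 : ∀ n, R (n + 1) 0 = a * R n 0 + b * R n 1)
    (hrec : ∀ n k, R (n + 1) (k + 1) = R n k + s * R n (k + 1) + t * R n (k + 2)) (n k : ℕ) :
    ((tridiag a b s t) ^ n) (Pi.single k 1) 0 = R n k := by
  induction n generalizing k with
  | zero =>
    rcases k with _ | k
    · simp [hR00]
    · simp [htri 0 (k + 1) (by omega)]
  | succ n ih =>
    rw [pow_succ, Module.End.mul_apply]
    rcases k with _ | k
    · simp [tridiag_single_zero, ih, hcol0]
    · simp [tridiag_single_succ, ih, hrec]

theorem tridiag_pow_recursive {D : ℕ → ℝ} (hD0 : D 0 = 1) (hD1 : D 1 = b)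
    (hD : ∀ k, D (k + 2) = t * D (k + 1))
    (hcol0 : ∀ n, R (n + 1) 0 = a * R n 0 + b * R n 1)
    (hrec : ∀ n k, R (n + 1) (k + 1) = R n k + s * R n (k + 1) + t * R n (k + 2)) (n m : ℕ) :
    ((tridiag a b s t) ^ m) (fun k => D k * R n k) = fun k => D k * R (n + m) k := by
  induction m with
  | zero => simp
  | succ m ih =>
    rw [pow_succ', Module.End.mul_apply, ih, ← add_assoc]
    ext k
    match k with
    | 0 => rw [tridiag_zero, hcol0, hD0, hD1]; ring
    | 1 => rw [tridiag_one, hrec, hD 0, hD0, hD1]; ring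
    | k + 2 => rw [tridiag_add_two, hrec, hD (k + 1), hD k]; ring

end tridiag

theorem catalanLike_hankel_TP (a b s t : ℝ) (ha : 0 ≤ a) (hb : 0 ≤ b) (hs : 0 ≤ s)
    (ht : 0 ≤ t) (h1 : s ^ 2 ≥ 4 * t) (h2 : a * (s + Real.sqrt (s ^ 2 - 4 * t)) / 2 ≥ b)
    (R : ℕ → ℕ → ℝ)
    (hR00 : R 0 0 = 1)
    (htri : ∀ n k, n < k → R n k = 0)
    (hcol0 : ∀ n, R (n + 1) 0 = a * R n 0 + b * R n 1)
    (hrec : ∀ n k, R (n + 1) (k + 1) = R n k + s * R n (k + 1) + t * R n (k + 2)) :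
    IsTP (fun n m => R (n + m) 0) := by
  have hR : IsTP R := by
    have := (isTP_single.tridiag_pow ha hb hs ht h1 h2).transpose
    simpa only [tridiag_pow_single_zero hR00 htri hcol0 hrec] using this
  let D : ℕ → ℝ := fun k => if k = 0 then 1 else b * t ^ (k - 1)
  have hD : ∀ k, 0 ≤ D k := by
    intro k
    simp only [D]
    split_ifs <;> positivity
  have hDrec : ∀ k, D (k + 2) = t * D (k + 1) := by
    intro k
    simp [D, pow_succ]
    ring
  have := (hR.mul_col hD).tridiag_pow ha hb hs ht h1 h2
  simpa only [tridiag_pow_recursive (show D 0 = 1 by simp [D]) (show D 1 = b by simp [D]) hDrec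
    hcol0 hrec, show D 0 = 1 by simp [D], one_mul] using this
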